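/- Let (b_n)_{n≥1} be a nonnegative real sequence belonging to GM(β*, 2). Then the series ∑_{n=1}^∞ b_n sin(nx) converges uniformly in x on ℝ if and only if n·b_n → 0 as n → ∞. -/

import Mathlib

open Finset Filter

/-- The class `GM(β*, r)` for real sequences: `b` belongs to it if there exist `K > 0` and
`c > 1` such that for every `m ≥ 1`,
`∑_{n=m}^{2m-1} |b_n − b_{n+r}| ≤ K (∑_{k=m}^{m+r-1} |b_k| + ∑_{k=max(1,⌊m/c⌋)}^{⌊cm⌋} |b_k|/k)`. -/
def GMstar (b : ℕ → ℝ) (r : ℕ) : Prop :=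
  ∃ K : ℝ, 0 < K ∧ ∃ c : ℝ, 1 < c ∧ ∀ m : ℕ, 1 ≤ m →
    (∑ n ∈ Finset.Icc m (2 * m - 1), |b n - b (n + r)|) ≤
      K * ((∑ k ∈ Finset.Icc m (m + r - 1), |b k|) +
        ∑ k ∈ Finset.Icc (max 1 ⌊(m : ℝ) / c⌋₊) ⌊c * (m : ℝ)⌋₊, |b k| / (k : ℝ))

/-- The partial sums of the sine series `∑ b_n sin (n x)`. -/
noncomputable def sinePartialSum (b : ℕ → ℝ) (N : ℕ) (x : ℝ) : ℝ :=
  ∑ n ∈ Finset.Icc 1 N, b n * Real.sin (n * x)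

theorem div_two_mul_le_max_one_floor {c : ℝ} (hc : 1 < c) (m : ℕ) :
    (m : ℝ) / (2 * c) ≤ (max 1 ⌊(m : ℝ) / c⌋₊ : ℕ) := by
  have h : (m : ℝ) / (2 * c) = (m : ℝ) / c / 2 := by field_simp
  have h1 : (1 : ℝ) ≤ (max 1 ⌊(m : ℝ) / c⌋₊ : ℕ) := by exact_mod_cast le_max_left _ _
  have h2 : ((⌊(m : ℝ) / c⌋₊ : ℕ) : ℝ) ≤ (max 1 ⌊(m : ℝ) / c⌋₊ : ℕ) := by
    exact_mod_cast le_max_right _ _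
  have h3 := Nat.lt_floor_add_one ((m : ℝ) / c)
  rw [h]
  linarith

theorem sum_Icc_inv_sq_le {a : ℕ} (ha : 1 ≤ a) (N : ℕ) :
    ∑ k ∈ Icc a N, ((k : ℝ) ^ 2)⁻¹ ≤ 2 / a := by
  have h := sum_Ioo_inv_sq_le (α := ℝ) (a - 1) (N + 1)
  have he : Ioo (a - 1) (N + 1) = Icc a N := by
    ext k
    simp only [mem_Ioo, mem_Icc]
    omega
  rw [he] at h
  rwa [Nat.cast_sub ha, Nat.cast_one, sub_add_cancel] at h

/-- The inequality defining `GMstar b 2` for fixed constants, for a nonnegative sequence `b`. -/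
def GMTwoBound (b : ℕ → ℝ) (K c : ℝ) : Prop :=
  ∀ m : ℕ, 1 ≤ m → ∑ n ∈ Ico m (2 * m), |b n - b (n + 2)| ≤
    K * (b m + b (m + 1) + ∑ k ∈ Icc (max 1 ⌊(m : ℝ) / c⌋₊) ⌊c * (m : ℝ)⌋₊, b k / (k : ℝ))

theorem GMstar.exists_gmTwoBound {b : ℕ → ℝ} (hb : ∀ n, 0 ≤ b n) (h : GMstar b 2) :
    ∃ K : ℝ, 0 < K ∧ ∃ c : ℝ, 1 < c ∧ GMTwoBound b K c := by
  obtain ⟨K, hK, c, hc, h⟩ := h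
  refine ⟨K, hK, c, hc, fun m hm => ?_⟩
  have h1 := h m hm
  have e1 : Icc m (2 * m - 1) = Ico m (2 * m) := by
    ext k
    simp only [mem_Ico, mem_Icc]
    omega
  have e2 : Icc m (m + 2 - 1) = {m, m + 1} := by
    ext k
    simp only [mem_insert, mem_singleton, mem_Icc]
    omega
  rw [e1, e2, sum_pair (by omega)] at h1
  simpa only [abs_of_nonneg (hb _)] using h1

section Sufficiency

variable {b : ℕ → ℝ} {K c ε : ℝ} {n₀ m : ℕ}

theorem GMTwoBound.sum_block_le (h : GMTwoBound b K c) (hK : 0 < K) (hc : 1 < c) (hε : 0 ≤ ε)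
    (hn : ∀ k, n₀ ≤ k → (k : ℝ) * b k ≤ ε) (hm : 1 ≤ m) (hm₀ : 2 * c * n₀ ≤ m) :
    ∑ n ∈ Ico m (2 * m), |b n - b (n + 2)| ≤ K * (2 + 4 * c) * ε / m := by
  refine (h m hm).trans ?_
  have hmpos : (0 : ℝ) < m := by exact_mod_cast hm
  have hnm : n₀ ≤ m := by
    have : (n₀ : ℝ) ≤ m := by nlinarith [(Nat.cast_nonneg n₀ : (0 : ℝ) ≤ n₀)]
    exact_mod_cast this
  have hle : ∀ k, n₀ ≤ k → 1 ≤ k → b k ≤ ε / k := fun k hk hk1 => by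
    have : (0 : ℝ) < k := by exact_mod_cast hk1
    rw [le_div_iff₀ this, mul_comm]
    exact hn k hk
  have h1 : b m ≤ ε / m := hle m hnm hm
  have h2 : b (m + 1) ≤ ε / m := by
    refine (hle (m + 1) (by omega) (by omega)).trans ?_
    gcongr
    simp
  set a := max 1 ⌊(m : ℝ) / c⌋₊ with ha
  have ha1 : 1 ≤ a := le_max_left _ _
  have ham : (m : ℝ) / (2 * c) ≤ a := div_two_mul_le_max_one_floor hc m
  have hna : n₀ ≤ a := by
    have : (n₀ : ℝ) ≤ m / (2 * c) := by
      rw [le_div_iff₀ (by positivity)]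
      linarith
    exact_mod_cast this.trans ham
  have h3 : ∑ k ∈ Icc a ⌊c * (m : ℝ)⌋₊, b k / (k : ℝ) ≤ 4 * c * ε / m := by
    calc ∑ k ∈ Icc a ⌊c * (m : ℝ)⌋₊, b k / (k : ℝ)
        ≤ ∑ k ∈ Icc a ⌊c * (m : ℝ)⌋₊, ε * ((k : ℝ) ^ 2)⁻¹ := by
          refine sum_le_sum fun k hk => ?_
          have hak := (mem_Icc.1 hk).1
          have hk0 : (0 : ℝ) < k := by exact_mod_cast (ha1.trans hak)
          have := hle k (hna.trans hak) (ha1.trans hak)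
          calc b k / k ≤ ε / k / k := by gcongr
            _ = ε * ((k : ℝ) ^ 2)⁻¹ := by field_simp
      _ = ε * ∑ k ∈ Icc a ⌊c * (m : ℝ)⌋₊, ((k : ℝ) ^ 2)⁻¹ := (mul_sum _ _ _).symm
      _ ≤ ε * (2 / a) := by
          gcongr
          exact sum_Icc_inv_sq_le ha1 _
      _ ≤ ε * (2 / (m / (2 * c))) := by gcongr
      _ = 4 * c * ε / m := by field_simp; ring
  calc K * (b m + b (m + 1) + ∑ k ∈ Icc a ⌊c * (m : ℝ)⌋₊, b k / (k : ℝ))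
      ≤ K * (ε / m + ε / m + 4 * c * ε / m) := by gcongr
    _ = K * (2 + 4 * c) * ε / m := by ring

theorem sum_Ico_le_of_sum_dyadic_le {f : ℕ → ℝ} {D : ℝ} (hf : ∀ n, 0 ≤ f n) {M : ℕ}
    (h : ∀ m, 1 ≤ m → M ≤ m → ∑ n ∈ Ico m (2 * m), f n ≤ D / m) (hm : 1 ≤ m)
    (hM : M ≤ m) (q : ℕ) : ∑ n ∈ Ico m q, f n ≤ 2 * D / m := by
  have hD : 0 ≤ D := by
    have h1 := (sum_nonneg fun n _ => hf n).trans (h m hm hM)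
    have hmpos : (0 : ℝ) < m := by exact_mod_cast hm
    rw [le_div_iff₀ hmpos] at h1
    linarith
  have key : ∀ j m : ℕ, 1 ≤ m → M ≤ m → ∑ n ∈ Ico m (2 ^ j * m), f n ≤ 2 * D / m := by
    intro j
    induction j with
    | zero =>
      intro m _ _
      simp only [pow_zero, one_mul, Ico_self, sum_empty]
      positivity
    | succ j ih =>
      intro m hm hM
      have h1 := ih (2 * m) (by omega) (by omega)
      have h2 := h m hm hM
      have hp : 1 ≤ 2 ^ j := Nat.one_le_two_pow
      rw [pow_succ, mul_assoc, ← sum_Ico_consecutive f (n := 2 * m) (by omega)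
        (Nat.le_mul_of_pos_left _ hp)]
      refine (add_le_add h2 h1).trans (le_of_eq ?_)
      have hmpos : (0 : ℝ) < m := by exact_mod_cast hm
      push_cast
      field_simp
      ring
  refine le_trans ?_ (key q m hm hM)
  refine sum_le_sum_of_subset_of_nonneg (Ico_subset_Ico_right ?_) fun n _ _ => hf n
  exact Nat.lt_two_pow_self.le.trans (Nat.le_mul_of_pos_right _ hm)

theorem two_sin_mul_sum_mul_sin (b : ℕ → ℝ) (x : ℝ) {p q : ℕ} (hpq : p ≤ q) :
    2 * Real.sin x * ∑ k ∈ Ico p q, b k * Real.sin (k * x) =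
      b p * Real.cos ((p - 1) * x) + b (p + 1) * Real.cos (p * x)
        - b q * Real.cos ((q - 1) * x) - b (q + 1) * Real.cos (q * x)
        + ∑ k ∈ Ico p q, (b (k + 2) - b k) * Real.cos ((k + 1) * x) := by
  induction q, hpq using Nat.le_induction with
  | base => simp
  | succ q hq ih =>
    rw [sum_Ico_succ_top hq, sum_Ico_succ_top hq, mul_add, ih]
    have e1 : Real.cos ((q - 1) * x) =
        Real.cos (q * x) * Real.cos x + Real.sin (q * x) * Real.sin x := by
      rw [sub_mul, one_mul, Real.cos_sub]
    have e2 : Real.cos ((q + 1) * x) =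
        Real.cos (q * x) * Real.cos x - Real.sin (q * x) * Real.sin x := by
      rw [add_mul, one_mul, Real.cos_add]
    push_cast
    rw [show ((q : ℝ) + 1 - 1) = q by ring, e1, e2]
    ring

theorem abs_sin_nat_mul_le (k : ℕ) (x : ℝ) : |Real.sin (k * x)| ≤ k * |Real.sin x| := by
  induction k with
  | zero => simp
  | succ k ih =>
    push_cast
    rw [add_mul, one_mul, Real.sin_add]
    refine (abs_add_le _ _).trans ?_
    rw [abs_mul, abs_mul]
    have h1 := mul_le_of_le_one_right (abs_nonneg (Real.sin (k * x))) (Real.abs_cos_le_one x)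
    have h2 := mul_le_of_le_one_left (abs_nonneg (Real.sin x)) (Real.abs_cos_le_one (k * x))
    linarith

theorem abs_sum_mul_sin_le_of_mul_le_one (hb : ∀ n, 0 ≤ b n) (hε : 0 ≤ ε)
    (hn : ∀ k, m ≤ k → (k : ℝ) * b k ≤ ε) {x : ℝ} {q : ℕ}
    (hq : ((q - m : ℕ) : ℝ) * |Real.sin x| ≤ 1) :
    |∑ k ∈ Ico m q, b k * Real.sin (k * x)| ≤ ε := by
  calc |∑ k ∈ Ico m q, b k * Real.sin (k * x)|
      ≤ ∑ k ∈ Ico m q, |b k * Real.sin (k * x)| := abs_sum_le_sum_abs _ _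
    _ ≤ ∑ k ∈ Ico m q, ε * |Real.sin x| := by
        refine sum_le_sum fun k hk => ?_
        rw [abs_mul, abs_of_nonneg (hb k)]
        calc b k * |Real.sin (k * x)| ≤ b k * (k * |Real.sin x|) :=
              mul_le_mul_of_nonneg_left (abs_sin_nat_mul_le k x) (hb k)
          _ = k * b k * |Real.sin x| := by ring
          _ ≤ ε * |Real.sin x| :=
              mul_le_mul_of_nonneg_right (hn k (mem_Ico.1 hk).1) (abs_nonneg _)
    _ = ε * (((q - m : ℕ) : ℝ) * |Real.sin x|) := by
        rw [sum_const, Nat.card_Ico, nsmul_eq_mul]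
        ring
    _ ≤ ε := mul_le_of_le_one_right hε hq

theorem abs_sum_mul_sin_le_of_one_le_mul {V : ℝ} {p q : ℕ} (hb : ∀ n, 0 ≤ b n) (hε : 0 ≤ ε)
    (hn : ∀ k, p ≤ k → (k : ℝ) * b k ≤ ε) {x : ℝ} (hp : 1 ≤ (p : ℝ) * |Real.sin x|)
    (hV : ∑ n ∈ Ico p q, |b n - b (n + 2)| ≤ 2 * V / p) :
    |∑ k ∈ Ico p q, b k * Real.sin (k * x)| ≤ 2 * ε + V := by
  have hp0 : (0 : ℝ) < p := by
    rcases (Nat.cast_nonneg p : (0 : ℝ) ≤ p).eq_or_lt with h | h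
    · rw [← h] at hp
      norm_num at hp
    · exact h
  have hV0 : 0 ≤ V := by
    have h1 := (sum_nonneg fun n _ => abs_nonneg (b n - b (n + 2))).trans hV
    rw [le_div_iff₀ hp0] at h1
    linarith
  rcases lt_or_ge q p with hqp | hpq
  · rw [Ico_eq_empty_of_le hqp.le]
    simp only [sum_empty, abs_zero]
    positivity
  have hle : ∀ k, p ≤ k → b k ≤ ε / p := fun k hk => by
    rw [le_div_iff₀ hp0, mul_comm]
    refine le_trans ?_ (hn k hk)
    exact mul_le_mul_of_nonneg_right (by exact_mod_cast hk) (hb k)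
  have hbc : ∀ k, p ≤ k → ∀ y, |b k * Real.cos y| ≤ ε / p := fun k hk y => by
    rw [abs_mul, abs_of_nonneg (hb k)]
    exact (mul_le_of_le_one_right (hb k) (Real.abs_cos_le_one y)).trans (hle k hk)
  have hsum : |∑ k ∈ Ico p q, (b (k + 2) - b k) * Real.cos ((k + 1) * x)| ≤ 2 * V / p := by
    refine (abs_sum_le_sum_abs _ _).trans (le_trans (sum_le_sum fun k _ => ?_) hV)
    rw [abs_mul, abs_sub_comm]
    exact mul_le_of_le_one_right (abs_nonneg _) (Real.abs_cos_le_one _)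
  have habel := two_sin_mul_sum_mul_sin b x hpq
  set T := ∑ k ∈ Ico p q, b k * Real.sin (k * x)
  have hbound : |2 * Real.sin x * T| ≤ (4 * ε + 2 * V) / p := by
    rw [habel]
    have h1 := abs_le.1 (hbc p le_rfl ((p - 1) * x))
    have h2 := abs_le.1 (hbc (p + 1) (by omega) (p * x))
    have h3 := abs_le.1 (hbc q hpq ((q - 1) * x))
    have h4 := abs_le.1 (hbc (q + 1) (by omega) (q * x))
    have h5 := abs_le.1 hsum
    have e : (4 * ε + 2 * V) / p = 4 * (ε / p) + 2 * V / p := by ring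
    rw [e, abs_le]
    constructor <;> linarith [h1.1, h1.2, h2.1, h2.2, h3.1, h3.2, h4.1, h4.2, h5.1, h5.2]
  rw [le_div_iff₀ hp0, abs_mul, abs_mul, abs_two] at hbound
  nlinarith [mul_le_mul_of_nonneg_right hp (abs_nonneg T)]

theorem GMTwoBound.abs_sum_mul_sin_le (h : GMTwoBound b K c) (hb : ∀ n, 0 ≤ b n) (hK : 0 < K)
    (hc : 1 < c) (hε : 0 ≤ ε) (hn : ∀ k, n₀ ≤ k → (k : ℝ) * b k ≤ ε) (hm : 1 ≤ m)
    (hm₀ : 2 * c * n₀ ≤ m) (N : ℕ) (x : ℝ) :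
    |∑ k ∈ Ico m N, b k * Real.sin (k * x)| ≤ (3 + K * (2 + 4 * c)) * ε := by
  set D := K * (2 + 4 * c) * ε with hD
  have hD0 : 0 ≤ D := by positivity
  have hnm : n₀ ≤ m := by
    have : (n₀ : ℝ) ≤ m := by nlinarith [(Nat.cast_nonneg n₀ : (0 : ℝ) ≤ n₀)]
    exact_mod_cast this
  have hvar : ∀ p, m ≤ p → ∑ n ∈ Ico p N, |b n - b (n + 2)| ≤ 2 * D / p := fun p hp => by
    refine sum_Ico_le_of_sum_dyadic_le (M := m) (fun _ => abs_nonneg _) ?_ (hm.trans hp) hp N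
    intro k hk hmk
    exact h.sum_block_le hK hc hε hn hk (hm₀.trans (by exact_mod_cast hmk))
  have hgoal : (3 + K * (2 + 4 * c)) * ε = ε + (2 * ε + D) := by rw [hD]; ring
  rw [hgoal]
  have hhead : ∀ q, ((q - m : ℕ) : ℝ) * |Real.sin x| ≤ 1 →
      |∑ k ∈ Ico m q, b k * Real.sin (k * x)| ≤ ε := fun q hq =>
    abs_sum_mul_sin_le_of_mul_le_one hb hε (fun k hk => hn k (hnm.trans hk)) hq
  have htail : ∀ p, m ≤ p → 1 ≤ (p : ℝ) * |Real.sin x| →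
      |∑ k ∈ Ico p N, b k * Real.sin (k * x)| ≤ 2 * ε + D := fun p hmp hp =>
    abs_sum_mul_sin_le_of_one_le_mul hb hε (fun k hk => hn k (hnm.trans (hmp.trans hk))) hp
      (hvar p hmp)
  rcases (abs_nonneg (Real.sin x)).eq_or_lt with hs | hs
  · have := hhead N (by rw [← hs]; simp)
    linarith
  set L := ⌊1 / |Real.sin x|⌋₊ + 1 with hL
  have hL1 : 1 ≤ (L : ℝ) * |Real.sin x| := by
    rw [← div_le_iff₀ hs, hL]
    push_cast
    exact (Nat.lt_floor_add_one _).le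
  have hL2 : ∀ q, q ≤ L → ((q - m : ℕ) : ℝ) * |Real.sin x| ≤ 1 := fun q hq => by
    rw [← le_div_iff₀ hs]
    have h1 : q - m ≤ ⌊1 / |Real.sin x|⌋₊ := by omega
    have h2 : ((q - m : ℕ) : ℝ) ≤ (⌊1 / |Real.sin x|⌋₊ : ℕ) := by exact_mod_cast h1
    exact h2.trans (Nat.floor_le (by positivity))
  rcases le_total L m with hLm | hmL
  · have h1 : (L : ℝ) ≤ m := by exact_mod_cast hLm
    have := htail m le_rfl (hL1.trans (mul_le_mul_of_nonneg_right h1 hs.le))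
    linarith
  rcases le_total N L with hNL | hLN
  · have := hhead N (hL2 N hNL)
    linarith
  rw [← sum_Ico_consecutive _ hmL hLN]
  exact (abs_add_le _ _).trans (add_le_add (hhead L (hL2 L le_rfl)) (htail L hmL hL1))

end Sufficiency

theorem sinePartialSum_sub (b : ℕ → ℝ) {m n : ℕ} (hmn : m ≤ n) (x : ℝ) :
    sinePartialSum b n x - sinePartialSum b m x =
      ∑ k ∈ Ico (m + 1) (n + 1), b k * Real.sin (k * x) := by
  have e : ∀ N, Icc 1 N = Ico 1 (N + 1) := fun N => by
    ext k
    simp only [mem_Ico, mem_Icc]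
    omega
  unfold sinePartialSum
  rw [e, e, ← sum_Ico_consecutive _ (show 1 ≤ m + 1 by omega) (show m + 1 ≤ n + 1 by omega)]
  ring

theorem exists_tendstoUniformly_of_forall_abs_sub_lt {u : ℕ → ℝ → ℝ}
    (h : ∀ ε > 0, ∃ N, ∀ m n, N ≤ m → m ≤ n → ∀ x, |u n x - u m x| < ε) :
    ∃ f, TendstoUniformly u f atTop := by
  have hc : UniformCauchySeqOn u atTop Set.univ := by
    rw [Metric.uniformCauchySeqOn_iff]
    intro ε hε
    obtain ⟨N, hN⟩ := h ε hε
    refine ⟨N, fun m hm n hn x _ => ?_⟩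
    rcases le_total m n with hmn | hnm
    · rw [dist_comm, Real.dist_eq]
      exact hN m n hm hmn x
    · rw [Real.dist_eq]
      exact hN n m hn hnm x
  have hlim : ∀ x, ∃ y, Tendsto (fun n => u n x) atTop (nhds y) := fun x =>
    cauchySeq_tendsto_of_complete (hc.cauchySeq (Set.mem_univ x))
  choose f hf using hlim
  exact ⟨f, tendstoUniformlyOn_univ.1 (hc.tendstoUniformlyOn_of_tendsto fun x _ => hf x)⟩

theorem GMTwoBound.exists_tendstoUniformly {b : ℕ → ℝ} {K c : ℝ} (h : GMTwoBound b K c)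
    (hb : ∀ n, 0 ≤ b n) (hK : 0 < K) (hc : 1 < c)
    (hlim : Tendsto (fun n : ℕ => (n : ℝ) * b n) atTop (nhds 0)) :
    ∃ f : ℝ → ℝ, TendstoUniformly (fun N x => sinePartialSum b N x) f atTop := by
  refine exists_tendstoUniformly_of_forall_abs_sub_lt fun δ hδ => ?_
  have hC : 0 < 3 + K * (2 + 4 * c) := by positivity
  set ε := δ / (2 * (3 + K * (2 + 4 * c))) with hεdef
  have hε : 0 < ε := by positivity
  obtain ⟨n₀, hn₀⟩ := eventually_atTop.1 (hlim.eventually_le_const hε)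
  refine ⟨⌈2 * c * n₀⌉₊, fun m n hm hmn x => ?_⟩
  rw [sinePartialSum_sub b hmn]
  have hm₀ : 2 * c * n₀ ≤ ((m + 1 : ℕ) : ℝ) := by
    have h1 : (⌈2 * c * n₀⌉₊ : ℝ) ≤ m := by exact_mod_cast hm
    push_cast
    linarith [Nat.le_ceil (2 * c * n₀)]
  refine (h.abs_sum_mul_sin_le hb hK hc hε.le hn₀ (by omega) hm₀ _ x).trans_lt ?_
  have : (3 + K * (2 + 4 * c)) * ε = δ / 2 := by
    rw [hεdef]
    field_simp
  linarith

section Necessity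

variable {b : ℕ → ℝ}

theorem half_le_sin {y : ℝ} (h0 : 0 < y) (h1 : y ≤ 1) : y / 2 ≤ Real.sin y := by
  have h := Real.sin_gt_sub_cube h0
  nlinarith [mul_nonneg h0.le (mul_nonneg (sub_nonneg.2 h1) (by linarith : (0 : ℝ) ≤ 1 + y))]

theorem exists_sum_Icc_mul_le_of_tendstoUniformly (hb : ∀ n, 0 ≤ b n) {f : ℝ → ℝ}
    (hf : TendstoUniformly (fun N x => sinePartialSum b N x) f atTop) {C : ℕ} (hC : 1 ≤ C)
    {ε : ℝ} (hε : 0 < ε) :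
    ∃ M, ∀ m, M ≤ m → ∑ k ∈ Icc m (C * m), b k ≤ ε := by
  have hC0 : (0 : ℝ) < C := by exact_mod_cast hC
  obtain ⟨N, hN⟩ := eventually_atTop.1
    (Metric.tendstoUniformly_iff.1 hf (ε / (4 * C)) (by positivity))
  refine ⟨N + 1, fun m hm => ?_⟩
  have hm0 : (0 : ℝ) < m := by
    have : 0 < m := by omega
    exact_mod_cast this
  set x : ℝ := 1 / (C * m) with hx
  have hmC : m ≤ C * m := Nat.le_mul_of_pos_left _ hC
  have h1 := hN (C * m) (by omega) x
  have h2 := hN (m - 1) (by omega) x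
  rw [Real.dist_eq, abs_lt] at h1 h2
  have h3 := sinePartialSum_sub b (show m - 1 ≤ C * m by omega) x
  have e : Ico (m - 1 + 1) (C * m + 1) = Icc m (C * m) := by
    ext k
    simp only [mem_Ico, mem_Icc]
    omega
  rw [e] at h3
  have h4 : ∑ k ∈ Icc m (C * m), b k * (1 / (2 * C)) ≤
      ∑ k ∈ Icc m (C * m), b k * Real.sin (k * x) := by
    refine sum_le_sum fun k hk => mul_le_mul_of_nonneg_left ?_ (hb k)
    obtain ⟨hk1, hk2⟩ := mem_Icc.1 hk
    have hk1' : (m : ℝ) ≤ k := by exact_mod_cast hk1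
    have hk2' : (k : ℝ) ≤ C * m := by exact_mod_cast hk2
    have hy1 : (k : ℝ) * x ≤ 1 := by
      rw [hx, mul_one_div, div_le_one (by positivity)]
      exact hk2'
    have hy0 : 1 / (C : ℝ) ≤ k * x := by
      rw [hx, mul_one_div, div_le_div_iff₀ hC0 (by positivity)]
      nlinarith
    have hpos : (0 : ℝ) < 1 / C := by positivity
    refine le_trans ?_ (half_le_sin (hpos.trans_le hy0) hy1)
    have : 1 / (2 * (C : ℝ)) = 1 / C / 2 := by field_simp
    linarith
  rw [← sum_mul] at h4
  have h5 : (∑ k ∈ Icc m (C * m), b k) * (1 / (2 * C)) ≤ ε * (1 / (2 * C)) := by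
    have : ε * (1 / (2 * (C : ℝ))) = ε / (4 * C) + ε / (4 * C) := by field_simp; ring
    linarith [h1.1, h1.2, h2.1, h2.2]
  exact le_of_mul_le_mul_right h5 (by positivity)

theorem le_add_add_sum_abs_sub (hb : ∀ n, 0 ≤ b n) {m n : ℕ} (hmn : m ≤ n) :
    b n ≤ b m + b (m + 1) + ∑ k ∈ Ico m (n - 1), |b k - b (k + 2)| := by
  induction n using Nat.strong_induction_on with
  | _ n ih =>
    rcases lt_or_ge n (m + 2) with hn | hn
    · have hs : 0 ≤ ∑ k ∈ Ico m (n - 1), |b k - b (k + 2)| :=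
        sum_nonneg fun _ _ => abs_nonneg _
      obtain rfl | rfl : n = m ∨ n = m + 1 := by omega
      · linarith [hb (n + 1)]
      · linarith [hb m]
    · obtain ⟨j, rfl⟩ : ∃ j, n = j + 2 := ⟨n - 2, by omega⟩
      have h1 := ih j (by omega) (by omega)
      have h2 : ∑ k ∈ Ico m (j - 1), |b k - b (k + 2)| ≤ ∑ k ∈ Ico m j, |b k - b (k + 2)| :=
        sum_le_sum_of_subset_of_nonneg (Ico_subset_Ico_right (Nat.sub_le _ _))
          fun _ _ _ => abs_nonneg _
      rw [show j + 2 - 1 = j + 1 by omega, sum_Ico_succ_top (by omega)]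
      linarith [neg_abs_le (b j - b (j + 2))]

theorem GMTwoBound.mul_le_of_sum_le {K c ε : ℝ} (h : GMTwoBound b K c) (hb : ∀ n, 0 ≤ b n)
    (hK : 0 < K) (hc : 1 < c) (hε : 0 ≤ ε) {C M : ℕ} (hC3 : 3 ≤ C) (hC : 2 * c ^ 2 ≤ C)
    (hM : ∀ m, M ≤ m → ∑ k ∈ Icc m (C * m), b k ≤ ε) {n : ℕ} (hn1 : 1 ≤ n)
    (hn : 4 * c * M ≤ n) : (n : ℝ) * b n ≤ 4 * (1 + K + 2 * K * c) * ε := by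
  have hn0 : (0 : ℝ) < n := by exact_mod_cast hn1
  have hpt : ∀ m, m ≤ n → n ≤ 2 * m → b n ≤ (1 + K) * (b m + b (m + 1)) + K * (4 * c * ε / n) := by
    intro m hmn hnm
    have hm1 : 1 ≤ m := by omega
    have hnm' : (n : ℝ) ≤ 2 * m := by exact_mod_cast hnm
    have h1 := le_add_add_sum_abs_sub hb hmn
    have h2 : ∑ k ∈ Ico m (n - 1), |b k - b (k + 2)| ≤ ∑ k ∈ Ico m (2 * m), |b k - b (k + 2)| :=
      sum_le_sum_of_subset_of_nonneg (Ico_subset_Ico_right (by omega)) fun _ _ _ => abs_nonneg _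
    have h3 := h m hm1
    set a := max 1 ⌊(m : ℝ) / c⌋₊ with ha
    have ha1 : 1 ≤ a := le_max_left _ _
    have ha0 : (0 : ℝ) < a := by exact_mod_cast ha1
    have ham : (m : ℝ) / (2 * c) ≤ a := div_two_mul_le_max_one_floor hc m
    have ham' : (m : ℝ) ≤ a * (2 * c) := (div_le_iff₀ (by positivity)).1 ham
    have hMa : M ≤ a := by
      have h5 : (M : ℝ) * (2 * c) ≤ a * (2 * c) := by linarith
      exact_mod_cast le_of_mul_le_mul_right h5 (by positivity)
    have hCa : ⌊c * (m : ℝ)⌋₊ ≤ C * a := by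
      refine Nat.floor_le_of_le ?_
      push_cast
      calc c * (m : ℝ) ≤ c * (a * (2 * c)) := by gcongr
        _ = 2 * c ^ 2 * a := by ring
        _ ≤ C * a := by gcongr
    have h4 : ∑ k ∈ Icc a ⌊c * (m : ℝ)⌋₊, b k / (k : ℝ) ≤ 4 * c * ε / n := by
      calc ∑ k ∈ Icc a ⌊c * (m : ℝ)⌋₊, b k / (k : ℝ)
          ≤ ∑ k ∈ Icc a ⌊c * (m : ℝ)⌋₊, b k / (a : ℝ) := by
            refine sum_le_sum fun k hk => div_le_div_of_nonneg_left (hb k) ha0 ?_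
            exact_mod_cast (mem_Icc.1 hk).1
        _ = (∑ k ∈ Icc a ⌊c * (m : ℝ)⌋₊, b k) / a := (sum_div _ _ _).symm
        _ ≤ ε / a := by
            refine div_le_div_of_nonneg_right (le_trans ?_ (hM a hMa)) ha0.le
            exact sum_le_sum_of_subset_of_nonneg (Icc_subset_Icc_right hCa) fun k _ _ => hb k
        _ ≤ 4 * c * ε / n := by
            rw [div_le_div_iff₀ ha0 hn0]
            have : (n : ℝ) ≤ 4 * c * a := by linarith
            nlinarith
    have h5 := mul_le_mul_of_nonneg_left h4 hK.le
    linarith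
  set s := (n + 1) / 2 with hs
  have hsM : M ≤ s := by
    have h1 : (M : ℝ) * 2 ≤ n := by nlinarith [(Nat.cast_nonneg M : (0 : ℝ) ≤ M)]
    have h2 : M * 2 ≤ n := by exact_mod_cast h1
    omega
  have hS1 : ∑ m ∈ Icc s n, b m ≤ ε :=
    (sum_le_sum_of_subset_of_nonneg (Icc_subset_Icc_right (by nlinarith [show n ≤ 2 * s by omega]))
      fun k _ _ => hb k).trans (hM s hsM)
  have hS2 : ∑ m ∈ Icc s n, b (m + 1) ≤ ε := by
    have e : ∑ m ∈ Icc s n, b (m + 1) = ∑ m ∈ Icc (s + 1) (n + 1), b m := by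
      rw [← Finset.map_add_right_Icc, sum_map]
      rfl
    rw [e]
    refine (sum_le_sum_of_subset_of_nonneg (Icc_subset_Icc (by omega) ?_)
      fun k _ _ => hb k).trans (hM s hsM)
    have h1 : n + 1 ≤ 3 * s := by omega
    nlinarith
  have hcard : (n : ℝ) / 2 ≤ ((n + 1 - s : ℕ) : ℝ) := by
    have h1 : n ≤ 2 * (n + 1 - s) := by omega
    have h2 : (n : ℝ) ≤ 2 * ((n + 1 - s : ℕ) : ℝ) := by exact_mod_cast h1
    linarith
  have hcard' : ((n + 1 - s : ℕ) : ℝ) ≤ n := by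
    have h1 : n + 1 - s ≤ n := by omega
    exact_mod_cast h1
  have hsum : ∑ _m ∈ Icc s n, b n ≤
      ∑ m ∈ Icc s n, ((1 + K) * (b m + b (m + 1)) + K * (4 * c * ε / n)) :=
    sum_le_sum fun m hm => hpt m (mem_Icc.1 hm).2 (by have := (mem_Icc.1 hm).1; omega)
  rw [sum_add_distrib, ← mul_sum, sum_add_distrib, sum_const, sum_const, Nat.card_Icc,
    nsmul_eq_mul, nsmul_eq_mul] at hsum
  have h1 : ((n + 1 - s : ℕ) : ℝ) * (K * (4 * c * ε / n)) ≤ n * (K * (4 * c * ε / n)) := by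
    gcongr
  have h2 : (n : ℝ) * (K * (4 * c * ε / n)) = 4 * K * c * ε := by field_simp
  have h3 := mul_le_mul_of_nonneg_right hcard (hb n)
  have h4 : (1 + K) * (∑ m ∈ Icc s n, b m + ∑ m ∈ Icc s n, b (m + 1)) ≤ (1 + K) * (ε + ε) := by
    gcongr
  linarith

theorem GMTwoBound.tendsto_mul_of_tendstoUniformly {K c : ℝ} (h : GMTwoBound b K c)
    (hb : ∀ n, 0 ≤ b n) (hK : 0 < K) (hc : 1 < c) {f : ℝ → ℝ}
    (hf : TendstoUniformly (fun N x => sinePartialSum b N x) f atTop) :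
    Tendsto (fun n : ℕ => (n : ℝ) * b n) atTop (nhds 0) := by
  rw [Metric.tendsto_atTop]
  intro δ hδ
  have hA : 0 < 4 * (1 + K + 2 * K * c) := by positivity
  set ε := δ / (2 * (4 * (1 + K + 2 * K * c))) with hεdef
  have hε : 0 < ε := by positivity
  have hC3 : 3 ≤ max 3 ⌈2 * c ^ 2⌉₊ := le_max_left _ _
  have hC : 2 * c ^ 2 ≤ (max 3 ⌈2 * c ^ 2⌉₊ : ℕ) :=
    (Nat.le_ceil _).trans (by exact_mod_cast le_max_right _ _)
  obtain ⟨M, hM⟩ := exists_sum_Icc_mul_le_of_tendstoUniformly hb hf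
    (show 1 ≤ max 3 ⌈2 * c ^ 2⌉₊ by omega) hε
  refine ⟨max 1 ⌈4 * c * M⌉₊, fun n hn => ?_⟩
  have hn1 : 4 * c * M ≤ n :=
    (Nat.le_ceil _).trans (by exact_mod_cast (le_max_right _ _).trans hn)
  have hle := h.mul_le_of_sum_le hb hK hc hε.le hC3 hC hM ((le_max_left _ _).trans hn) hn1
  have : 4 * (1 + K + 2 * K * c) * ε = δ / 2 := by
    rw [hεdef]
    field_simp
  rw [Real.dist_eq, sub_zero, abs_of_nonneg (mul_nonneg n.cast_nonneg (hb n))]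
  linarith

end Necessity

theorem uniform_convergence_iff_nbn_to_zero
    (b : ℕ → ℝ) (hb : ∀ n, 0 ≤ b n) (hgm : GMstar b 2) :
    (∃ f : ℝ → ℝ, TendstoUniformly (fun N x => sinePartialSum b N x) f atTop) ↔
      Tendsto (fun n : ℕ => (n : ℝ) * b n) atTop (nhds 0) := by
  obtain ⟨K, hK, c, hc, h⟩ := hgm.exists_gmTwoBound hb
  exact ⟨fun ⟨_, hf⟩ => h.tendsto_mul_of_tendstoUniformly hb hK hc hf,
    h.exists_tendstoUniformly hb hK hc⟩
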